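/- arXiv:1802.08305 — 5 statements merged into one kernel-verified Lean document; each statement's English description precedes it below -/
import Mathlib

section
/- Let R ⊆ ℝ³ be an open convex set, let r ∈ ℝ³ with r ∉ R, and let s ∈ S². Suppose the set L_R(r,s) is nonempty and set ℓ(r,s) = inf L_R(r,s). Then: (a) the point r − ℓ(r,s)·s lies on the frontier (topological boundary) of R; and (b) for every t ≥ 0, the point r + t·s does not belong to R, the set L_R(r + t·s, s) is nonempty, and inf L_R(r + t·s, s) = ℓ(r,s) + t. -/
noncomputable section

/-- Euclidean space ℝ³. -/
abbrev V : Type := EuclideanSpace ℝ (Fin 3)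

/-- The set `L_R(r,s) = {l ∈ ℝ : l > 0 ∧ r − l·s ∈ R}` of travel parameters. -/
def travelSet (R : Set V) (r s : V) : Set ℝ := {l : ℝ | 0 < l ∧ r - l • s ∈ R}

theorem isOpen_travelSet {R : Set V} (hR : IsOpen R) (r s : V) : IsOpen (travelSet R r s) :=
  (isOpen_lt continuous_const continuous_id).inter
    (hR.preimage (f := fun l : ℝ => r - l • s) (by fun_prop))

theorem bddBelow_travelSet (R : Set V) (r s : V) : BddBelow (travelSet R r s) :=
  ⟨0, fun _ hl => hl.1.le⟩

/-- A ray leaving a convex set does not come back to it. -/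
theorem add_smul_notMem_of_travelSet_nonempty {R : Set V} (hR : Convex ℝ R) {r s : V}
    (hr : r ∉ R) (hne : (travelSet R r s).Nonempty) {t : ℝ} (ht : 0 ≤ t) : r + t • s ∉ R := by
  obtain ⟨l, hl, hlR⟩ := hne
  intro h
  have hlt : 0 < l + t := by linarith
  refine hr ?_
  convert hR h hlR (div_nonneg hl.le hlt.le) (div_nonneg ht hlt.le) (by field_simp) using 1
  match_scalars <;> field_simp <;> ring

/-- Moving the base point by `t • s` translates the travel set by `t`. -/
theorem travelSet_add_smul {R : Set V} (hR : Convex ℝ R) {r s : V}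
    (hr : r ∉ R) (hne : (travelSet R r s).Nonempty) {t : ℝ} (ht : 0 ≤ t) :
    travelSet R (r + t • s) s = OrderIso.addRight t '' travelSet R r s := by
  ext l
  have h : r + t • s - l • s = r - (l - t) • s := by module
  simp only [travelSet, Set.mem_ofPred_eq, h, Set.mem_image, OrderIso.addRight_apply]
  constructor
  · rintro ⟨-, hlR⟩
    refine ⟨l - t, ⟨?_, hlR⟩, by ring⟩
    by_contra! hle
    refine add_smul_notMem_of_travelSet_nonempty hR hr hne (t := t - l) (by linarith) ?_
    convert hlR using 1
    module
  · rintro ⟨m, ⟨hm, hmR⟩, rfl⟩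
    exact ⟨by linarith, by simpa using hmR⟩

theorem sub_sInf_travelSet_smul_mem_frontier {R : Set V} (hR : IsOpen R) {r s : V}
    (hr : r ∉ R) (hne : (travelSet R r s).Nonempty) :
    r - sInf (travelSet R r s) • s ∈ frontier R := by
  have hbdd := bddBelow_travelSet R r s
  rw [hR.frontier_eq]
  constructor
  · exact map_mem_closure (f := fun l : ℝ => r - l • s) (by fun_prop)
      (csInf_mem_closure hne hbdd) fun l hl => hl.2
  · intro hmem
    have hpos : 0 < sInf (travelSet R r s) := by
      refine lt_of_le_of_ne (le_csInf hne fun _ hl => hl.1.le) fun h0 => hr ?_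
      simpa [← h0] using hmem
    obtain ⟨ε, hε, hball⟩ := Metric.isOpen_iff.1 (isOpen_travelSet hR r s) _ ⟨hpos, hmem⟩
    have hlt := csInf_le hbdd (hball (a := sInf (travelSet R r s) - ε / 2)
      (by rw [Metric.mem_ball, Real.dist_eq, abs_lt]; constructor <;> linarith))
    linarith

/-- Geometric properties of the travel distance `ℓ(r,s) = inf L_R(r,s)`:
the foot point lies on the boundary of `R`, and the travel distance grows
linearly along the ray (Section 3 of the paper). -/
theorem travel_distance_properties
    (R : Set V) (hRopen : IsOpen R) (hRconv : Convex ℝ R)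
    (r s : V) (hr : r ∉ R) (hs : ‖s‖ = 1)
    (hne : (travelSet R r s).Nonempty) :
    (r - sInf (travelSet R r s) • s ∈ frontier R) ∧
    (∀ t : ℝ, 0 ≤ t →
      r + t • s ∉ R ∧ (travelSet R (r + t • s) s).Nonempty ∧
      sInf (travelSet R (r + t • s) s) = sInf (travelSet R r s) + t) := by
  refine ⟨sub_sInf_travelSet_smul_mem_frontier hRopen hr hne, fun t ht =>
    ⟨add_smul_notMem_of_travelSet_nonempty hRconv hr hne ht, ?_, ?_⟩⟩
  · rw [travelSet_add_smul hRconv hr hne ht]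
    exact hne.image _
  · rw [travelSet_add_smul hRconv hr hne ht,
      ← OrderIso.map_csInf' _ hne (bddBelow_travelSet R r s), OrderIso.addRight_apply]
end
end

section
/- Let R ⊆ ℝ³ be an open convex set, let a ≥ 0 be a real number, and let u : ℝ³ × S² → ℝ be any function. For r ∉ R and s ∈ S² with L_R(r,s) nonempty, define the extension (E^a u)(r,s) = exp(−a·ℓ(r,s)) · u(r − ℓ(r,s)·s, s), where ℓ(r,s) = inf L_R(r,s). Then for every such (r,s) and every t ≥ 0, the value (E^a u)(r + t·s, s) is defined (i.e., r + t·s ∉ R and L_R(r + t·s, s) is nonempty), and (E^a u)(r + t·s, s) = exp(−a·t) · (E^a u)(r,s). -/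
noncomputable section

/-- The travel distance `ℓ(r,s) = inf L_R(r,s)`. -/
noncomputable def travelDist (R : Set V) (r s : V) : ℝ := sInf (travelSet R r s)

/-- The extension operator `(E^a u)(r,s) = exp(−a·ℓ(r,s)) · u(r − ℓ(r,s)·s, s)`
of Theorem 3.2. -/
noncomputable def Eext (R : Set V) (a : ℝ) (u : V → V → ℝ) (r s : V) : ℝ :=
  Real.exp (-(a * travelDist R r s)) * u (r - travelDist R r s • s) s

/-- If `r ∉ R` and the backward ray from `r` meets the convex set `R`, then `R` meets the whole
line through `r` only behind `r`. -/
theorem pos_of_sub_smul_mem {R : Set V} (hR : Convex ℝ R) {r s : V} (hr : r ∉ R)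
    (hne : (travelSet R r s).Nonempty) {m : ℝ} (hm : r - m • s ∈ R) : 0 < m := by
  obtain ⟨l, hl, hlR⟩ := hne
  by_contra! hm0
  have hd : 0 < l - m := by linarith
  refine hr ?_
  have key := hR hlR hm (a := -m / (l - m)) (b := l / (l - m))
    (div_nonneg (by linarith) hd.le) (div_nonneg hl.le hd.le) (by field_simp; ring)
  convert key using 1
  match_scalars <;> field_simp <;> ring

theorem travelDist_add_smul {R : Set V} (hR : Convex ℝ R) {r s : V} (hr : r ∉ R)
    (hne : (travelSet R r s).Nonempty) {t : ℝ} (ht : 0 ≤ t) :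
    travelDist R (r + t • s) s = travelDist R r s + t := by
  have hbdd : BddBelow (travelSet R r s) := ⟨0, fun l hl => hl.1.le⟩
  rw [travelDist, travelSet_add_smul hR hr hne ht, ← OrderIso.map_csInf' _ hne hbdd]
  rfl

/-- The extension `E^a u` decays exponentially with rate `a` along straight rays
outside `R`, i.e. it solves the purely absorbing transport equation along rays. -/
theorem Eext_decay_along_rays
    (R : Set V) (hRopen : IsOpen R) (hRconv : Convex ℝ R)
    (a : ℝ) (ha : 0 ≤ a) (u : V → V → ℝ)
    (r s : V) (hr : r ∉ R) (hs : ‖s‖ = 1)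
    (hne : (travelSet R r s).Nonempty)
    (t : ℝ) (ht : 0 ≤ t) :
    (r + t • s ∉ R ∧ (travelSet R (r + t • s) s).Nonempty) ∧
    Eext R a u (r + t • s) s = Real.exp (-(a * t)) * Eext R a u r s := by
  refine ⟨⟨fun h => ?_, ?_⟩, ?_⟩
  · have h0 : r - (-t) • s ∈ R := by simpa using h
    linarith [pos_of_sub_smul_mem hRconv hr hne h0]
  · rw [travelSet_add_smul hRconv hr hne ht]
    exact hne.image _
  · have hpt : r + t • s - (travelDist R r s + t) • s = r - travelDist R r s • s := by module
    rw [Eext, Eext, travelDist_add_smul hRconv hr hne ht, hpt, ← mul_assoc, ← Real.exp_add]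
    congr 2
    ring
end
end

section
/- Let R ⊆ ℝ³ be an open convex set and R^ℓ ⊆ ℝ³ a bounded open convex set with closure(R) ⊆ R^ℓ. Let a ≥ 0 and ℓ₀ > 0, and let w : ℝ³ × S² → ℝ be bounded on closure(R^ℓ) × S². Assume: (i) for every s ∈ S² and r ∈ ℝ³, the map t ↦ w(r + t·s, s) is continuous at every t with r + t·s ∈ closure(R^ℓ) \ R, and at every t with r + t·s ∈ R^ℓ \ closure(R) it is differentiable with derivative −a·w(r + t·s, s); (ii) (zero inflow at the outer boundary) w(r', s) = 0 for every r' ∈ frontier(R^ℓ) and s ∈ S² such that r' + t·s ∈ R^ℓ for some t > 0. Then for every r ∈ frontier(R^ℓ) and s ∈ S²: (a) if L_R(r,s) is nonempty and inf L_R(r,s) ≥ ℓ₀, then |w(r,s)| ≤ exp(−a·ℓ₀) · sup{ |w(r',s')| : r' ∈ frontier(R), s' ∈ S² }; (b) if the set {l ∈ ℝ : l > 0 and r − l·s ∈ closure(R)} is empty and r − t·s ∈ R^ℓ for some t > 0, then w(r,s) = 0. -/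
noncomputable section

/-- A continuous solution of `f' = -a f` on an interval decays exponentially. -/
theorem eq_exp_mul_of_hasDerivAt_neg_mul {f : ℝ → ℝ} {a u v : ℝ} (huv : u < v)
    (hf : ContinuousOn f (Set.Icc u v))
    (hf' : ∀ t ∈ Set.Ioo u v, HasDerivAt f (-(a * f t)) t) :
    f v = Real.exp (-(a * (v - u))) * f u := by
  obtain ⟨c, -, hc⟩ := exists_hasDerivAt_eq_slope (fun t => Real.exp (a * t) * f t)
    (fun _ => 0) huv (ContinuousOn.mul (by fun_prop) hf) fun t ht => by
      have hexp : HasDerivAt (fun t => Real.exp (a * t)) (Real.exp (a * t) * (a * 1)) t :=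
        ((hasDerivAt_id t).const_mul a).exp
      refine (hexp.mul (hf' t ht)).congr_deriv ?_
      ring
  have hne : v - u ≠ 0 := by linarith
  have heq : Real.exp (a * v) * f v = Real.exp (a * u) * f u := by
    field_simp at hc
    linarith
  have hsplit : Real.exp (-(a * (v - u))) = Real.exp (-(a * v)) * Real.exp (a * u) := by
    rw [← Real.exp_add]
    congr 1
    ring
  rw [hsplit, mul_assoc, ← heq, ← mul_assoc, ← Real.exp_add]
  simp

/-- On a line, the parameters strictly between one in the closure of an open convex set and one
in the set itself belong to the set. -/
theorem Convex.add_smul_mem_of_mem_closure_of_mem {E : Type*} [NormedAddCommGroup E]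
    [NormedSpace ℝ E] {C : Set E} (hC : Convex ℝ C) (hCo : IsOpen C) {x s : E} {u v t : ℝ}
    (hu : x + u • s ∈ closure C) (hv : x + v • s ∈ C) (ht : t ∈ openSegment ℝ u v) :
    x + t • s ∈ C := by
  obtain ⟨α, β, hα, hβ, hαβ, rfl⟩ := ht
  have h := hC.combo_closure_interior_mem_interior hu (hCo.interior_eq.symm ▸ hv) hα.le hβ hαβ
  rw [hCo.interior_eq] at h
  convert h using 1
  have hx : x = (α + β) • x := by rw [hαβ, one_smul]
  nth_rewrite 1 [hx]
  simp only [smul_eq_mul]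
  module

/-- A bounded set meets every ray in a bounded set of parameters. -/
theorem Bornology.IsBounded.bddAbove_ray {E : Type*} [NormedAddCommGroup E] [NormedSpace ℝ E]
    {C : Set E} (hC : Bornology.IsBounded C) (r : E) {s : E} (hs : ‖s‖ = 1) :
    BddAbove {t : ℝ | r - t • s ∈ C} := by
  obtain ⟨K, hK⟩ := hC.exists_norm_le
  refine ⟨K + ‖r‖, fun t ht => ?_⟩
  have h : ‖t • s‖ ≤ ‖r‖ + ‖r - t • s‖ := by
    simpa using norm_sub_le r (r - t • s)
  rw [norm_smul, hs, mul_one] at h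
  have := hK _ ht
  have := le_abs_self t
  rw [Real.norm_eq_abs] at h
  linarith

/-- Pointwise form of the exponential decay estimate of Theorem 3.2 / Lemma 3.3:
in the purely absorbing extension layer `R^ℓ \ closure R` the solution of
`s·∇w + a·w = 0` with zero inflow at the outer boundary is exponentially small
(or zero) at the outer boundary `frontier R^ℓ`. -/
theorem decay_in_absorbing_layer
    (R Rl : Set V) (hRopen : IsOpen R) (hRconv : Convex ℝ R)
    (hRlopen : IsOpen Rl) (hRlconv : Convex ℝ Rl) (hRlbdd : Bornology.IsBounded Rl)
    (hsub : closure R ⊆ Rl)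
    (a l₀ : ℝ) (ha : 0 ≤ a) (hl₀ : 0 < l₀)
    (w : V → V → ℝ)
    (hbdd : ∃ M : ℝ, ∀ r ∈ closure Rl, ∀ s : V, ‖s‖ = 1 → |w r s| ≤ M)
    -- (i) continuity and the absorbing transport ODE along rays in the layer
    (hcont : ∀ s : V, ‖s‖ = 1 → ∀ r : V, ∀ t : ℝ,
      r + t • s ∈ closure Rl \ R → ContinuousAt (fun τ : ℝ => w (r + τ • s) s) t)
    (hderiv : ∀ s : V, ‖s‖ = 1 → ∀ r : V, ∀ t : ℝ,
      r + t • s ∈ Rl \ closure R →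
      HasDerivAt (fun τ : ℝ => w (r + τ • s) s) (-(a * w (r + t • s) s)) t)
    -- (ii) zero inflow at the outer boundary
    (hinflow : ∀ r' ∈ frontier Rl, ∀ s : V, ‖s‖ = 1 →
      (∃ t > (0:ℝ), r' + t • s ∈ Rl) → w r' s = 0)
    (r : V) (hr : r ∈ frontier Rl) (s : V) (hs : ‖s‖ = 1) :
    -- (a) exponential smallness of the outer trace
    ((travelSet R r s).Nonempty → l₀ ≤ sInf (travelSet R r s) →
      |w r s| ≤ Real.exp (-(a * l₀)) *
        sSup {x : ℝ | ∃ r' ∈ frontier R, ∃ s' : V, ‖s'‖ = 1 ∧ x = |w r' s'|}) ∧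
    -- (b) vanishing on rays missing `closure R`
    ({l : ℝ | 0 < l ∧ r - l • s ∈ closure R} = ∅ →
      (∃ t > (0:ℝ), r - t • s ∈ Rl) → w r s = 0) := by
  have hcl : closure R ⊆ closure Rl := hsub.trans subset_closure
  have hrRl : r ∉ Rl := by
    rw [hRlopen.frontier_eq] at hr
    exact hr.2
  have hrcl : r ∈ closure Rl := frontier_subset_closure hr
  have hrcl' : r + (0 : ℝ) • s ∈ closure Rl := by simpa using hrcl
  have hneg : ∀ l : ℝ, r - l • s = r + (-l) • s := fun l => by module
  have decay : ∀ T : ℝ, 0 < T → r + (-T) • s ∈ closure Rl \ R →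
      (∀ t ∈ Set.Ioo (-T) 0, r + t • s ∈ Rl \ closure R) →
      w r s = Real.exp (-(a * T)) * w (r + (-T) • s) s := by
    intro T hT hend hmid
    have hf := eq_exp_mul_of_hasDerivAt_neg_mul (f := fun τ : ℝ => w (r + τ • s) s)
      (a := a) (neg_lt_zero.2 hT) (fun t ht => (hcont s hs r t ?_).continuousWithinAt)
      (fun t ht => hderiv s hs r t (hmid t ht))
    · simpa using hf
    · rcases ht.1.eq_or_lt with rfl | h₁
      · exact hend
      rcases ht.2.eq_or_lt with rfl | h₂
      · exact ⟨hrcl', by simpa using fun h => hrRl (hsub (subset_closure h))⟩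
      · exact ⟨subset_closure (hmid t ⟨h₁, h₂⟩).1,
          fun h => (hmid t ⟨h₁, h₂⟩).2 (subset_closure h)⟩
  refine ⟨fun hne hl => ?_, fun hempty ⟨t₀, ht₀, ht₀Rl⟩ => ?_⟩
  · set T := sInf (travelSet R r s)
    have hT : 0 < T := hl₀.trans_le hl
    have hbb : BddBelow (travelSet R r s) := ⟨0, fun l h => h.1.le⟩
    have hTcl : r + (-T) • s ∈ closure R := by
      rw [← hneg]
      have hmaps : Set.MapsTo (fun l : ℝ => r - l • s) (travelSet R r s) R := fun l h => h.2
      exact hmaps.closure (by fun_prop) (csInf_mem_closure hne hbb)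
    have hbelow : ∀ l, 0 < l → l < T → r - l • s ∉ R := fun l h₀ hlT h =>
      (csInf_le hbb ⟨h₀, h⟩).not_gt hlT
    have hTR : r + (-T) • s ∉ R := by
      rw [← hneg]
      intro h
      have hev : ∀ᶠ l in nhds T, r - l • s ∈ R :=
        ((by fun_prop : Continuous fun l : ℝ => r - l • s).tendsto T).eventually
          (hRopen.mem_nhds h)
      obtain ⟨l, ⟨hlR, hl0⟩, hlT⟩ := (((hev.and (lt_mem_nhds hT)).filter_mono
        nhdsWithin_le_nhds).and (self_mem_nhdsWithin : Set.Iio T ∈ nhdsWithin T _)).exists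
      exact hbelow l hl0 hlT hlR
    obtain ⟨l₁, hl₁⟩ := hne
    have hTl₁ : T ≤ l₁ := csInf_le hbb hl₁
    have hw := decay T hT ⟨hcl hTcl, hTR⟩ fun t ht => ⟨
      hRlconv.add_smul_mem_of_mem_closure_of_mem hRlopen hrcl' (hsub hTcl) (by
        rw [openSegment_symm, openSegment_eq_Ioo (neg_lt_zero.2 hT)]
        exact ht), fun h => by
      obtain ⟨m, hm₁, hm₂⟩ := exists_between ht.1
      refine hbelow (-m) (by linarith [ht.2]) (by linarith) ?_
      rw [hneg, neg_neg]
      refine hRconv.add_smul_mem_of_mem_closure_of_mem hRopen h (hneg l₁ ▸ hl₁.2) ?_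
      rw [openSegment_symm, openSegment_eq_Ioo (by linarith [ht.1])]
      exact ⟨by linarith, hm₂⟩⟩
    rw [hw, abs_mul, Real.abs_exp]
    obtain ⟨M, hM⟩ := hbdd
    gcongr
    refine le_csSup ⟨M, ?_⟩ ⟨_, ?_, s, hs, rfl⟩
    · rintro x ⟨r', hr', s', hs', rfl⟩
      exact hM r' (hcl (frontier_subset_closure hr')) s' hs'
    · rw [hRopen.frontier_eq]
      exact ⟨hTcl, hTR⟩
  · have hba := hRlbdd.bddAbove_ray r hs
    set T := sSup {t : ℝ | r - t • s ∈ Rl}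
    have hne : {t : ℝ | r - t • s ∈ Rl}.Nonempty := ⟨t₀, ht₀Rl⟩
    have hTcl : r + (-T) • s ∈ closure Rl := by
      rw [← hneg]
      have hmaps : Set.MapsTo (fun l : ℝ => r - l • s) {t : ℝ | r - t • s ∈ Rl} Rl :=
        fun l h => h
      exact hmaps.closure (by fun_prop) (csSup_mem_closure hne hba)
    have hTRl : r + (-T) • s ∉ Rl := by
      rw [← hneg]
      intro h
      have hev : ∀ᶠ l in nhds T, r - l • s ∈ Rl :=
        ((by fun_prop : Continuous fun l : ℝ => r - l • s).tendsto T).eventually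
          (hRlopen.mem_nhds h)
      obtain ⟨l, hlRl, hlT⟩ := ((hev.filter_mono nhdsWithin_le_nhds).and
        (self_mem_nhdsWithin : Set.Ioi T ∈ nhdsWithin T _)).exists
      exact (le_csSup hba hlRl).not_gt hlT
    have ht₀T : t₀ < T := (le_csSup hba ht₀Rl).lt_of_ne fun h =>
      hTRl (by
      rw [← hneg]
      have hT : t₀ = T := h
      exact hT ▸ ht₀Rl)
    have hT : 0 < T := ht₀.trans ht₀T
    rw [hneg] at ht₀Rl
    have hzero : w (r + (-T) • s) s = 0 := by
      refine hinflow _ ?_ s hs ⟨T - t₀, sub_pos.2 ht₀T, ?_⟩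
      · rw [hRlopen.frontier_eq]
        exact ⟨hTcl, hTRl⟩
      · convert ht₀Rl using 1
        module
    rw [decay T hT ⟨hTcl, fun h => hTRl (hsub (subset_closure h))⟩ fun t ht => ⟨?_, fun h => ?_⟩,
      hzero, mul_zero]
    · rcases lt_trichotomy t (-t₀) with h | rfl | h
      · refine hRlconv.add_smul_mem_of_mem_closure_of_mem hRlopen hTcl ht₀Rl ?_
        rw [openSegment_eq_Ioo (by linarith)]
        exact ⟨ht.1, h⟩
      · exact ht₀Rl
      · refine hRlconv.add_smul_mem_of_mem_closure_of_mem hRlopen hrcl' ht₀Rl ?_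
        rw [openSegment_symm, openSegment_eq_Ioo (by linarith)]
        exact ⟨h, ht.2⟩
    · have hmem : -t ∈ {l : ℝ | 0 < l ∧ r - l • s ∈ closure R} :=
        ⟨neg_pos.2 ht.2, by rwa [hneg, neg_neg]⟩
      rwa [hempty] at hmem
end
end

section
/- Let R ⊆ ℝ³ and let R^ℓ ⊆ ℝ³ be a bounded open convex set. Let a > 0, s ∈ S², r ∈ frontier(R^ℓ), and t* > 0 be such that r + t*·s ∈ frontier(R^ℓ) and r + t·s ∈ R^ℓ \ closure(R) for all t ∈ (0, t*). Let w : ℝ³ × S² → ℝ satisfy: (i) the map t ↦ w(r + t·s, s) is continuous on [0, t*] and differentiable on (0, t*) with derivative −a·w(r + t·s, s); (ii) the map t ↦ w(r + t·s, −s) is continuous on [0, t*] and differentiable on (0, t*) with derivative +a·w(r + t·s, −s); (iii) (reflection inequalities) |w(r, s)| ≤ |w(r, −s)| and |w(r + t*·s, −s)| ≤ |w(r + t*·s, s)|. Then w(r + t·s, s) = 0 and w(r + t·s, −s) = 0 for all t ∈ [0, t*]. -/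
noncomputable section

/-- A solution of `f' = c f` on `(0, T)`, continuous up to the endpoints, is exponential. -/
theorem eq_mul_exp_of_hasDerivAt_Ioo {f : ℝ → ℝ} {c T : ℝ}
    (hf : ContinuousOn f (Set.Icc 0 T))
    (hd : ∀ t ∈ Set.Ioo (0 : ℝ) T, HasDerivAt f (c * f t) t) :
    ∀ t ∈ Set.Icc (0 : ℝ) T, f t = f 0 * Real.exp (c * t) := by
  intro t ht
  rcases ht.1.eq_or_lt with rfl | hpos
  · simp
  have hcont : ContinuousOn (fun x => f x * Real.exp (-(c * x))) (Set.Icc 0 t) :=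
    (hf.mono (Set.Icc_subset_Icc_right ht.2)).mul (by fun_prop)
  have hderiv : ∀ x ∈ Set.Ioo (0 : ℝ) t,
      HasDerivAt (fun x => f x * Real.exp (-(c * x))) 0 x := by
    intro x hx
    have hexp : HasDerivAt (fun x => Real.exp (-(c * x))) (Real.exp (-(c * x)) * (-(c * 1))) x :=
      ((hasDerivAt_id x).const_mul c).neg.exp
    exact ((hd x ⟨hx.1, hx.2.trans_le ht.2⟩).mul hexp).congr_deriv (by ring)
  obtain ⟨-, -, hslope⟩ := exists_hasDerivAt_eq_slope _ (fun _ => 0) hpos hcont hderiv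
  have hconst : f t * Real.exp (-(c * t)) = f 0 := by
    rcases div_eq_zero_iff.mp hslope.symm with h | h
    · simpa [sub_eq_zero] using h
    · linarith
  rw [← hconst, mul_assoc, ← Real.exp_add]
  simp

/-- Key step (eq:star) in the proof of Theorem 4.3: a solution of the purely
absorbing transport equation `s·∇w + a·w = 0` along a chord of `R^ℓ` that does
not meet `closure R`, subject to damping reflection conditions at the two
endpoints of the chord, vanishes identically along the chord. -/
theorem vanishing_on_chords
    (R Rl : Set V) (hRlopen : IsOpen Rl) (hRlconv : Convex ℝ Rl)
    (hRlbdd : Bornology.IsBounded Rl)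
    (a : ℝ) (ha : 0 < a) (s : V) (hs : ‖s‖ = 1)
    (r : V) (hr : r ∈ frontier Rl) (tstar : ℝ) (htstar : 0 < tstar)
    (hr' : r + tstar • s ∈ frontier Rl)
    (hchord : ∀ t ∈ Set.Ioo (0:ℝ) tstar, r + t • s ∈ Rl \ closure R)
    (w : V → V → ℝ)
    -- (i) absorbing transport equation along the chord in direction s
    (hc1 : ContinuousOn (fun t : ℝ => w (r + t • s) s) (Set.Icc 0 tstar))
    (hd1 : ∀ t ∈ Set.Ioo (0:ℝ) tstar,
      HasDerivAt (fun τ : ℝ => w (r + τ • s) s) (-(a * w (r + t • s) s)) t)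
    -- (ii) absorbing transport equation along the chord in direction −s
    (hc2 : ContinuousOn (fun t : ℝ => w (r + t • s) (-s)) (Set.Icc 0 tstar))
    (hd2 : ∀ t ∈ Set.Ioo (0:ℝ) tstar,
      HasDerivAt (fun τ : ℝ => w (r + τ • s) (-s)) (a * w (r + t • s) (-s)) t)
    -- (iii) reflection inequalities at the two endpoints
    (hrefl1 : |w r s| ≤ |w r (-s)|)
    (hrefl2 : |w (r + tstar • s) (-s)| ≤ |w (r + tstar • s) s|) :
    ∀ t ∈ Set.Icc (0:ℝ) tstar, w (r + t • s) s = 0 ∧ w (r + t • s) (-s) = 0 := by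
  have h1 := eq_mul_exp_of_hasDerivAt_Ioo (c := -a) hc1 (by simpa using hd1)
  have h2 := eq_mul_exp_of_hasDerivAt_Ioo (c := a) hc2 hd2
  simp only [zero_smul, add_zero] at h1 h2
  have hT : tstar ∈ Set.Icc 0 tstar := ⟨htstar.le, le_rfl⟩
  rw [h1 _ hT, h2 _ hT, abs_mul, abs_mul, Real.abs_exp, Real.abs_exp] at hrefl2
  have haT : 0 < a * tstar := mul_pos ha htstar
  have hlt : Real.exp (-a * tstar) < Real.exp (a * tstar) := Real.exp_lt_exp.mpr (by linarith)
  have hdecay : |w r s| * Real.exp (-a * tstar) ≤ |w r (-s)| * Real.exp (-a * tstar) := by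
    gcongr
  have hin : w r (-s) = 0 := by
    by_contra hne
    have := mul_lt_mul_of_pos_left hlt (abs_pos.mpr hne)
    linarith
  have hout : w r s = 0 := by simpa [hin] using hrefl1
  intro t ht
  simp [h1 t ht, h2 t ht, hin, hout]
end
end

section
/- Let Ω ⊆ ℝ³ be open, μ : ℝ³ → ℝ, k : ℝ³ × ℝ → ℝ measurable, and q, w : ℝ³ × S² → ℝ. Assume that for each s ∈ S² the map r ↦ w(r,s) is differentiable on Ω, and that for each r ∈ Ω and s ∈ S² the function s' ↦ k(r, s·s')·w(r,s') is σ-integrable. Define (Dw)(r,s) = s·∇_r w(r,s), (Kw)(r,s) = ∫_{S²} k(r, s·s') w(r,s') dσ(s'), and for f ∈ {w, q} the even and odd parts f⁺(r,s) = (f(r,s) + f(r,−s))/2 and f⁻(r,s) = (f(r,s) − f(r,−s))/2. Then the following are equivalent: (i) for all (r,s) ∈ Ω × S²: (Dw)(r,s) + μ(r)·w(r,s) = (Kw)(r,s) + q(r,s); (ii) for all (r,s) ∈ Ω × S²: (Dw⁻)(r,s) + μ(r)·w⁺(r,s) = (Kw⁺)(r,s) + q⁺(r,s) and (Dw⁺)(r,s)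 + μ(r)·w⁻(r,s) = (Kw⁻)(r,s) + q⁻(r,s). -/
open MeasureTheory
open scoped RealInnerProductSpace

noncomputable section

/-- The unit sphere S² in ℝ³. -/
abbrev S2 := Metric.sphere (0 : V) 1

/-- Even part `f⁺(r,s) = (f(r,s) + f(r,−s))/2`. -/
def evenPart (f : V → S2 → ℝ) : V → S2 → ℝ := fun r s => (f r s + f r (-s)) / 2

/-- Odd part `f⁻(r,s) = (f(r,s) − f(r,−s))/2`. -/
def oddPart (f : V → S2 → ℝ) : V → S2 → ℝ := fun r s => (f r s - f r (-s)) / 2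

/-- The streaming operator `(Df)(r,s) = s·∇_r f(r,s)`. -/
noncomputable def Dop (f : V → S2 → ℝ) : V → S2 → ℝ :=
  fun r s => fderiv ℝ (fun r' => f r' s) r (s : V)

/-- The scattering operator `(Kf)(r,s) = ∫_{S²} k(r, s·s') f(r,s') dσ(s')`. -/
noncomputable def Kop (σ : Measure S2) (k : V → ℝ → ℝ) (f : V → S2 → ℝ) :
    V → S2 → ℝ :=
  fun r s => ∫ s', k r ⟪(s : V), (s' : V)⟫ * f r s' ∂σ

theorem Dop_oddPart {w : V → S2 → ℝ} {r : V} (hw : ∀ s : S2, DifferentiableAt ℝ (fun r => w r s) r)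
    (s : S2) : Dop (oddPart w) r s = (Dop w r s + Dop w r (-s)) / 2 := by
  have h := ((hw s).hasFDerivAt.sub (hw (-s)).hasFDerivAt).mul_const (2⁻¹ : ℝ)
  have h' : HasFDerivAt (fun r' => oddPart w r' s) _ r := h
  simp only [Dop, h'.fderiv, smul_apply, sub_apply,
    smul_eq_mul, coe_neg_sphere, map_neg]
  ring

theorem Dop_evenPart {w : V → S2 → ℝ} {r : V} (hw : ∀ s : S2, DifferentiableAt ℝ (fun r => w r s) r)
    (s : S2) : Dop (evenPart w) r s = (Dop w r s - Dop w r (-s)) / 2 := by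
  have h := ((hw s).hasFDerivAt.add (hw (-s)).hasFDerivAt).mul_const (2⁻¹ : ℝ)
  have h' : HasFDerivAt (fun r' => evenPart w r' s) _ r := h
  simp only [Dop, h'.fderiv, smul_apply, add_apply,
    smul_eq_mul, coe_neg_sphere, map_neg]
  ring

theorem measurePreserving_neg_sphere {σ : Measure S2}
    (hσ : Measure.map (fun s : S2 => -s) σ = σ) :
    MeasurePreserving (Homeomorph.neg S2) σ σ :=
  ⟨(Homeomorph.neg S2).continuous.measurable, hσ⟩

theorem integrable_kernel_mul_comp_neg {σ : Measure S2}
    (hσ : Measure.map (fun s : S2 => -s) σ = σ) {k : V → ℝ → ℝ} {w : V → S2 → ℝ} {r : V}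
    (hint : ∀ s : S2, Integrable (fun s' : S2 => k r ⟪(s : V), (s' : V)⟫ * w r s') σ) (s : S2) :
    Integrable (fun s' : S2 => k r ⟪(s : V), (s' : V)⟫ * w r (-s')) σ := by
  have h := (measurePreserving_neg_sphere hσ).integrable_comp_of_integrable (hint (-s))
  simpa [Function.comp_def] using h

theorem Kop_neg {σ : Measure S2} (hσ : Measure.map (fun s : S2 => -s) σ = σ)
    (k : V → ℝ → ℝ) (w : V → S2 → ℝ) (r : V) (s : S2) :
    Kop σ k w r (-s) = ∫ s' : S2, k r ⟪(s : V), (s' : V)⟫ * w r (-s') ∂σ := by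
  have h := (measurePreserving_neg_sphere hσ).integral_comp
    (Homeomorph.neg S2).measurableEmbedding
    (fun s' : S2 => k r ⟪((-s : S2) : V), (s' : V)⟫ * w r s')
  rw [Kop, ← h]
  simp

theorem Kop_evenPart {σ : Measure S2} (hσ : Measure.map (fun s : S2 => -s) σ = σ)
    {k : V → ℝ → ℝ} {w : V → S2 → ℝ} {r : V}
    (hint : ∀ s : S2, Integrable (fun s' : S2 => k r ⟪(s : V), (s' : V)⟫ * w r s') σ) (s : S2) :
    Kop σ k (evenPart w) r s = (Kop σ k w r s + Kop σ k w r (-s)) / 2 := by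
  rw [Kop_neg hσ, Kop, Kop, ← integral_add (hint s) (integrable_kernel_mul_comp_neg hσ hint s),
    ← integral_div]
  congr 1 with s'
  rw [evenPart]
  ring

theorem Kop_oddPart {σ : Measure S2} (hσ : Measure.map (fun s : S2 => -s) σ = σ)
    {k : V → ℝ → ℝ} {w : V → S2 → ℝ} {r : V}
    (hint : ∀ s : S2, Integrable (fun s' : S2 => k r ⟪(s : V), (s' : V)⟫ * w r s') σ) (s : S2) :
    Kop σ k (oddPart w) r s = (Kop σ k w r s - Kop σ k w r (-s)) / 2 := by
  rw [Kop_neg hσ, Kop, Kop, ← integral_sub (hint s) (integrable_kernel_mul_comp_neg hσ hint s),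
    ← integral_div]
  congr 1 with s'
  rw [oddPart]
  ring

/-- Interior-equation part of Lemma 5.1: the radiative transfer equation is
equivalent to the coupled even–odd system obtained by splitting all functions
into even and odd parts with respect to the direction variable. Here `σ` is
the surface measure on S², invariant under the antipodal map. -/
theorem rte_even_odd_system_equiv
    (σ : Measure S2) (hσ : Measure.map (fun s : S2 => -s) σ = σ)
    (Ω : Set V) (hΩ : IsOpen Ω)
    (μ : V → ℝ) (k : V → ℝ → ℝ) (hk : Measurable (Function.uncurry k))
    (q w : V → S2 → ℝ)
    (hdiff : ∀ s : S2, DifferentiableOn ℝ (fun r => w r s) Ω)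
    (hint : ∀ r ∈ Ω, ∀ s : S2,
      Integrable (fun s' : S2 => k r ⟪(s : V), (s' : V)⟫ * w r s') σ) :
    (∀ r ∈ Ω, ∀ s : S2,
      Dop w r s + μ r * w r s = Kop σ k w r s + q r s) ↔
    (∀ r ∈ Ω, ∀ s : S2,
      (Dop (oddPart w) r s + μ r * evenPart w r s =
        Kop σ k (evenPart w) r s + evenPart q r s) ∧
      (Dop (evenPart w) r s + μ r * oddPart w r s =
        Kop σ k (oddPart w) r s + oddPart q r s)) := by
  refine forall₂_congr fun r hr => ?_
  have hw (s : S2) : DifferentiableAt ℝ (fun r => w r s) r :=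
    (hdiff s).differentiableAt (hΩ.mem_nhds hr)
  simp only [Dop_oddPart hw, Dop_evenPart hw, Kop_evenPart hσ (hint r hr),
    Kop_oddPart hσ (hint r hr)]
  unfold evenPart oddPart
  refine ⟨fun h s => ?_, fun h s => ?_⟩
  · constructor <;> linarith [h s, h (-s)]
  · linarith [(h s).1, (h s).2]
end
end
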